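/- There exist finite stable configuration structures E and F (as in the paper's Example 14, each built from a-labelled events with a non-binary conflict among three initial events) such that E and F are both history-preserving (H) equivalent and hereditary weak history-preserving (HWH) equivalent, but E and F are not hereditary history-preserving (HH) equivalent. -/

import Mathlib

open scoped Classical

noncomputable section

namespace EILPaper

/-- A configuration structure over event type `E` and alphabet `Act`:
a family of finite sets of events (configurations) together with a labelling. -/
structure CS (E Act : Type) where
  Conf : Set (Finset E)
  label : E → Act

namespace CS

variable {E Act : Type}

/-- Causality order `d ≤_X e`. -/
def le (C : CS E Act) (X : Finset E) (d e : E) : Prop :=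
  ∀ Y ∈ C.Conf, Y ⊆ X → e ∈ Y → d ∈ Y

/-- Stability of a configuration structure. -/
structure Stable (C : CS E Act) : Prop where
  rooted : ∅ ∈ C.Conf
  connected : ∀ X ∈ C.Conf, X ≠ ∅ → ∃ e ∈ X, X.erase e ∈ C.Conf
  unionClosed : ∀ X ∈ C.Conf, ∀ Y ∈ C.Conf, ∀ Z ∈ C.Conf, X ∪ Y ⊆ Z → X ∪ Y ∈ C.Conf
  interClosed : ∀ X ∈ C.Conf, ∀ Y ∈ C.Conf, ∀ Z ∈ C.Conf, X ∪ Y ⊆ Z → X ∩ Y ∈ C.Conf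

/-- Single-event forward transition `X →^e X'`. -/
def TranE (C : CS E Act) (X X' : Finset E) (e : E) : Prop :=
  X ∈ C.Conf ∧ X' ∈ C.Conf ∧ X ⊆ X' ∧ X' \ X = {e}

/-- Label-indexed forward transition `X →^a X'`. -/
def TranA (C : CS E Act) (X X' : Finset E) (a : Act) : Prop :=
  ∃ e, C.TranE X X' e ∧ C.label e = a

/-- Reverse transition `X ⇝^e X'`. -/
def RTranE (C : CS E Act) (X X' : Finset E) (e : E) : Prop := C.TranE X' X e

/-- Reverse transition `X ⇝^a X'`. -/
def RTranA (C : CS E Act) (X X' : Finset E) (a : Act) : Prop := C.TranA X' X a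

/-- Image-finiteness with respect to forward transitions. -/
def ImageFinite (C : CS E Act) : Prop :=
  ∀ X ∈ C.Conf, ∀ a : Act, {X' | C.TranA X X' a}.Finite

/-- A configuration structure is finite if its set of configurations is finite. -/
def Finite (C : CS E Act) : Prop := C.Conf.Finite

/-- The events of a configuration structure. -/
def events (C : CS E Act) : Set E := {e | ∃ X ∈ C.Conf, e ∈ X}

end CS

variable {E E1 E2 E3 Id Act : Type}

/-- `f` is a label-preserving order isomorphism from configuration `X` of `C`
to configuration `Y` of `D`. -/
def IsIso (C : CS E1 Act) (D : CS E2 Act) (X : Finset E1) (Y : Finset E2)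
    (f : E1 → E2) : Prop :=
  (∀ e ∈ X, f e ∈ Y) ∧
  (∀ d ∈ X, ∀ e ∈ X, f d = f e → d = e) ∧
  (∀ e' ∈ Y, ∃ e ∈ X, f e = e') ∧
  (∀ e ∈ X, D.label (f e) = C.label e) ∧
  (∀ d ∈ X, ∀ e ∈ X, (C.le X d e ↔ D.le Y (f d) (f e)))

/-- `X ≅ Y`: the configurations are isomorphic. -/
def Isom (C : CS E1 Act) (D : CS E2 Act) (X : Finset E1) (Y : Finset E2) : Prop :=
  ∃ f, IsIso C D X Y f

/-- Formulas of Event Identifier Logic (EIL). -/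
inductive EIL (Id Act : Type) : Type
  | tt : EIL Id Act
  | neg : EIL Id Act → EIL Id Act
  | conj : EIL Id Act → EIL Id Act → EIL Id Act
  | fwd : Id → Act → EIL Id Act → EIL Id Act   -- forward diamond ⟨x:a⟩φ
  | decl : Id → Act → EIL Id Act → EIL Id Act  -- declaration (x:a)φ
  | rev : Id → EIL Id Act → EIL Id Act         -- reverse diamond ⟨x⟩φ

namespace EIL

/-- Free identifiers of a formula. -/
def fi : EIL Id Act → Set Id
  | .tt => ∅
  | .neg φ => φ.fi
  | .conj φ ψ => φ.fi ∪ ψ.fi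
  | .fwd x _ φ => φ.fi \ {x}
  | .decl x _ φ => φ.fi \ {x}
  | .rev x φ => φ.fi ∪ {x}

/-- A formula is closed if it has no free identifiers. -/
def Closed (φ : EIL Id Act) : Prop := φ.fi = ∅

end EIL

/-- `ρ` is a permissible environment for `φ` and `X`. -/
def Permissible (φ : EIL Id Act) (ρ : Id → Option E) (X : Finset E) : Prop :=
  ∀ x ∈ φ.fi, ∃ e ∈ X, ρ x = some e

/-- The satisfaction relation `C, X, ρ ⊨ φ`. -/
def Sat (C : CS E Act) : EIL Id Act → Finset E → (Id → Option E) → Prop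
  | .tt, _, _ => True
  | .neg φ, X, ρ => ¬ Sat C φ X ρ
  | .conj φ ψ, X, ρ => Sat C φ X ρ ∧ Sat C ψ X ρ
  | .fwd x a φ, X, ρ =>
      ∃ e X', C.TranE X X' e ∧ C.label e = a ∧
        Sat C φ X' (Function.update ρ x (some e))
  | .decl x a φ, X, ρ =>
      ∃ e ∈ X, C.label e = a ∧ Sat C φ X (Function.update ρ x (some e))
  | .rev x φ, X, ρ =>
      ∃ e X', C.RTranE X X' e ∧ ρ x = some e ∧ Permissible φ ρ X' ∧ Sat C φ X' ρ

/-- Satisfaction of a closed formula in a configuration: `C, X ⊨ φ`. -/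
def SatC (C : CS E Act) (φ : EIL Id Act) (X : Finset E) : Prop :=
  Sat C φ X fun _ => none

/-- Satisfaction of a closed formula by a structure: `C ⊨ φ`. -/
def SatS (C : CS E Act) (φ : EIL Id Act) : Prop := SatC C φ ∅

/-- The reverse-only sublogic EIL_ro. -/
inductive RO : EIL Id Act → Prop
  | tt : RO .tt
  | neg {φ} : RO φ → RO (.neg φ)
  | conj {φ ψ} : RO φ → RO ψ → RO (.conj φ ψ)
  | decl {x a φ} : RO φ → RO (.decl x a φ)
  | rev {x φ} : RO φ → RO (.rev x φ)

/-- The declaration-free reverse-only sublogic EIL_dfro. -/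
inductive DFRO : EIL Id Act → Prop
  | tt : DFRO .tt
  | neg {φ} : DFRO φ → DFRO (.neg φ)
  | conj {φ ψ} : DFRO φ → DFRO ψ → DFRO (.conj φ ψ)
  | rev {x φ} : DFRO φ → DFRO (.rev x φ)

/-- The sublogic EIL_h: no forward move may occur inside a reverse move. -/
inductive InH : EIL Id Act → Prop
  | tt : InH .tt
  | neg {φ} : InH φ → InH (.neg φ)
  | conj {φ ψ} : InH φ → InH ψ → InH (.conj φ ψ)
  | fwd {x a φ} : InH φ → InH (.fwd x a φ)
  | decl {x a φ} : InH φ → InH (.decl x a φ)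
  | ro {φ} : RO φ → InH φ

/-- The sublogic EIL_wh: all formulas are closed, reverse-only parts are closed. -/
inductive InWH : EIL Id Act → Prop
  | tt : InWH .tt
  | neg {φ} : InWH φ → InWH (.neg φ)
  | conj {φ ψ} : InWH φ → InWH ψ → InWH (.conj φ ψ)
  | fwd {x a φ} : InWH φ → x ∉ φ.fi → InWH (.fwd x a φ)
  | roClosed {φ} : RO φ → φ.Closed → InWH φ

/-- The sublogic EIL_hwh: forward diamonds only applied to closed formulas. -/
inductive InHWH : EIL Id Act → Prop
  | tt : InHWH .tt
  | neg {φ} : InHWH φ → InHWH (.neg φ)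
  | conj {φ ψ} : InHWH φ → InHWH ψ → InHWH (.conj φ ψ)
  | fwd {x a φ} : InHWH φ → φ.Closed → InHWH (.fwd x a φ)
  | decl {x a φ} : InHWH φ → InHWH (.decl x a φ)
  | rev {x φ} : InHWH φ → InHWH (.rev x φ)

/-- Logical equivalence of two structures with respect to a sublogic `L`. -/
def EquivL (L : EIL Id Act → Prop) (C : CS E1 Act) (D : CS E2 Act) : Prop :=
  ∀ φ : EIL Id Act, L φ → φ.Closed → (SatS C φ ↔ SatS D φ)

/-- Weak history-preserving bisimulation. -/
structure IsWHBisim (C : CS E1 Act) (D : CS E2 Act)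
    (R : Finset E1 → Finset E2 → Prop) : Prop where
  root : R ∅ ∅
  iso : ∀ X Y, R X Y → Isom C D X Y
  forth : ∀ X Y a X', R X Y → C.TranA X X' a → ∃ Y', D.TranA Y Y' a ∧ R X' Y'
  back : ∀ X Y a Y', R X Y → D.TranA Y Y' a → ∃ X', C.TranA X X' a ∧ R X' Y'

/-- History-preserving bisimulation. -/
structure IsHBisim (C : CS E1 Act) (D : CS E2 Act)
    (R : Finset E1 → Finset E2 → (E1 → E2) → Prop) : Prop where
  root : ∃ f, R ∅ ∅ f
  iso : ∀ X Y f, R X Y f → IsIso C D X Y f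
  forth : ∀ X Y f a X', R X Y f → C.TranA X X' a →
    ∃ Y' f', D.TranA Y Y' a ∧ R X' Y' f' ∧ ∀ e ∈ X, f' e = f e
  back : ∀ X Y f a Y', R X Y f → D.TranA Y Y' a →
    ∃ X' f', C.TranA X X' a ∧ R X' Y' f' ∧ ∀ e ∈ X, f' e = f e

/-- Hereditary history-preserving bisimulation. -/
structure IsHHBisim (C : CS E1 Act) (D : CS E2 Act)
    (R : Finset E1 → Finset E2 → (E1 → E2) → Prop)
    extends IsHBisim C D R : Prop where
  rforth : ∀ X Y f a X', R X Y f → C.RTranA X X' a →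
    ∃ Y' f', D.RTranA Y Y' a ∧ R X' Y' f' ∧ ∀ e ∈ X', f e = f' e
  rback : ∀ X Y f a Y', R X Y f → D.RTranA Y Y' a →
    ∃ X' f', C.RTranA X X' a ∧ R X' Y' f' ∧ ∀ e ∈ X', f e = f' e

/-- Hereditary weak history-preserving bisimulation. -/
structure IsHWHBisim (C : CS E1 Act) (D : CS E2 Act)
    (R : Finset E1 → Finset E2 → (E1 → E2) → Prop) : Prop where
  root : ∃ f, R ∅ ∅ f
  iso : ∀ X Y f, R X Y f → IsIso C D X Y f
  forth : ∀ X Y f a X', R X Y f → C.TranA X X' a →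
    ∃ Y' f', D.TranA Y Y' a ∧ R X' Y' f'
  back : ∀ X Y f a Y', R X Y f → D.TranA Y Y' a →
    ∃ X' f', C.TranA X X' a ∧ R X' Y' f'
  rforth : ∀ X Y f a X', R X Y f → C.RTranA X X' a →
    ∃ Y' f', D.RTranA Y Y' a ∧ R X' Y' f' ∧ ∀ e ∈ X', f e = f' e
  rback : ∀ X Y f a Y', R X Y f → D.RTranA Y Y' a →
    ∃ X' f', C.RTranA X X' a ∧ R X' Y' f' ∧ ∀ e ∈ X', f e = f' e

/-- WH equivalence. -/
def WHEquiv (C : CS E1 Act) (D : CS E2 Act) : Prop := ∃ R, IsWHBisim C D R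

/-- H equivalence. -/
def HEquiv (C : CS E1 Act) (D : CS E2 Act) : Prop := ∃ R, IsHBisim C D R

/-- HH equivalence. -/
def HHEquiv (C : CS E1 Act) (D : CS E2 Act) : Prop := ∃ R, IsHHBisim C D R

/-- HWH equivalence. -/
def HWHEquiv (C : CS E1 Act) (D : CS E2 Act) : Prop := ∃ R, IsHWHBisim C D R


section GraphStructures

theorem tranA_iff {A : Type} {C : CS A Unit} {X X' : Finset A} {a : Unit} :
    C.TranA X X' a ↔ X ∈ C.Conf ∧ X' ∈ C.Conf ∧
      ∃ e, e ∉ X ∧ ∀ x, x ∈ X' ↔ x = e ∨ x ∈ X := by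
  constructor
  · rintro ⟨e, ⟨h1, h2, h3, h4⟩, -⟩
    have h5 : ∀ x, (x ∈ X' ∧ x ∉ X) ↔ x = e := fun x => by
      rw [← Finset.mem_sdiff, h4, Finset.mem_singleton]
    refine ⟨h1, h2, e, ((h5 e).2 rfl).2, fun x => ?_⟩
    rw [← h5]
    have := @h3 x
    tauto
  · rintro ⟨h1, h2, e, he, h⟩
    refine ⟨e, ⟨h1, h2, fun x hx => (h x).2 (Or.inr hx), ?_⟩, rfl⟩
    ext x
    rw [Finset.mem_sdiff, h, Finset.mem_singleton]
    constructor
    · tauto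
    · rintro rfl
      exact ⟨Or.inl rfl, he⟩

variable {V W : Type}

/-- The configuration structure of a directed graph: every vertex `v` yields an initial event
`(v, false)` and an event `(v, true)` caused by it, and the maximal configurations are
`{(v, false), (v, true), (w, false)}` for the edges `v → w`. -/
def graphCS (out : V → V → Prop) : CS (V × Bool) Unit where
  Conf := {X | (∀ v, (v, true) ∈ X → (v, false) ∈ X) ∧
    ∃ v w, out v w ∧ ∀ e ∈ X, e = (v, false) ∨ e = (v, true) ∨ e = (w, false)}
  label := fun _ => ()

/-- The global causality order on the events of a `graphCS`. -/
def Prec (d e : V × Bool) : Prop := d.1 = e.1 ∧ (d.2 = true → e.2 = true)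

variable {out : V → V → Prop} {out' : W → W → Prop}

theorem Prec.refl (d : V × Bool) : Prec d d := ⟨rfl, id⟩

theorem Prec.eq_or {d e : V × Bool} (h : Prec d e) :
    d = e ∨ ∃ v, d = (v, false) ∧ e = (v, true) := by
  obtain ⟨v, b⟩ := d
  obtain ⟨w, c⟩ := e
  obtain ⟨h1, h2⟩ := h
  cases b <;> cases c <;> simp_all

theorem mem_of_prec {X : Finset (V × Bool)} (hX : X ∈ (graphCS out).Conf) {d e : V × Bool}
    (he : e ∈ X) (h : Prec d e) : d ∈ X := by
  rcases h.eq_or with rfl | ⟨v, rfl, rfl⟩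
  · exact he
  · exact hX.1 v he

theorem conf_of_subset {X Z : Finset (V × Bool)} (hZ : Z ∈ (graphCS out).Conf) (h : X ⊆ Z)
    (hX : ∀ v, (v, true) ∈ X → (v, false) ∈ X) : X ∈ (graphCS out).Conf := by
  obtain ⟨v, w, hvw, hZ⟩ := hZ.2
  exact ⟨hX, v, w, hvw, fun e he => hZ e (h he)⟩

theorem le_iff {X : Finset (V × Bool)} (hX : X ∈ (graphCS out).Conf) {d e : V × Bool}
    (he : e ∈ X) : (graphCS out).le X d e ↔ Prec d e := by
  constructor
  · intro h
    have hY : X.filter (fun x => Prec x e) ∈ (graphCS out).Conf := by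
      refine conf_of_subset hX (Finset.filter_subset _ _) fun v hv => ?_
      rw [Finset.mem_filter] at hv ⊢
      exact ⟨hX.1 v hv.1, hv.2.1, by simp⟩
    exact (Finset.mem_filter.1 (h _ hY (Finset.filter_subset _ _)
      (Finset.mem_filter.2 ⟨he, Prec.refl e⟩))).2
  · exact fun h Y hY _ heY => mem_of_prec hY heY h

theorem isIso_iff {X : Finset (V × Bool)} {Y : Finset (W × Bool)} {f : V × Bool → W × Bool}
    (hX : X ∈ (graphCS out).Conf) (hY : Y ∈ (graphCS out').Conf) :
    IsIso (graphCS out) (graphCS out') X Y f ↔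
      (∀ e ∈ X, f e ∈ Y) ∧ (∀ d ∈ X, ∀ e ∈ X, f d = f e → d = e) ∧
      (∀ e' ∈ Y, ∃ e ∈ X, f e = e') ∧ (∀ d ∈ X, ∀ e ∈ X, (Prec d e ↔ Prec (f d) (f e))) := by
  constructor
  · rintro ⟨h1, h2, h3, -, h5⟩
    refine ⟨h1, h2, h3, fun d hd e he => ?_⟩
    rw [← le_iff hX he, ← le_iff hY (h1 e he)]
    exact h5 d hd e he
  · rintro ⟨h1, h2, h3, h5⟩
    refine ⟨h1, h2, h3, fun _ _ => rfl, fun d hd e he => ?_⟩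
    rw [le_iff hX he, le_iff hY (h1 e he)]
    exact h5 d hd e he

theorem empty_mem_conf (h : ∃ v w, out v w) : ∅ ∈ (graphCS out).Conf := by
  obtain ⟨v, w, h⟩ := h
  exact ⟨by simp, v, w, h, by simp⟩

theorem erase_mem_conf {X : Finset (V × Bool)} (hX : X ∈ (graphCS out).Conf) {e : V × Bool}
    (h : ∀ d ∈ X, Prec e d → d = e) : X.erase e ∈ (graphCS out).Conf := by
  refine conf_of_subset hX (Finset.erase_subset _ _) fun v hv => ?_
  rw [Finset.mem_erase] at hv ⊢
  refine ⟨?_, hX.1 v hv.2⟩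
  rintro rfl
  exact hv.1 (h _ hv.2 ⟨rfl, by simp⟩)

theorem graphCS_stable (h : ∃ v w, out v w) : (graphCS out).Stable where
  rooted := empty_mem_conf h
  connected := by
    intro X hX hne
    by_cases ht : ∃ v, (v, true) ∈ X
    · obtain ⟨v, hv⟩ := ht
      refine ⟨_, hv, ?_⟩
      convert erase_mem_conf hX fun d _ hd => ?_
      rcases hd.eq_or with h | ⟨w, h1, -⟩
      · exact h.symm
      · simp at h1
    · obtain ⟨e, he⟩ := Finset.nonempty_iff_ne_empty.2 hne
      refine ⟨e, he, ?_⟩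
      convert erase_mem_conf hX fun d hd hde => ?_
      rcases hde.eq_or with h | ⟨w, -, rfl⟩
      · exact h.symm
      · exact absurd ⟨w, hd⟩ ht
  unionClosed := by
    intro X hX Y hY Z hZ hXY
    refine conf_of_subset hZ hXY fun v hv => ?_
    exact (@Finset.mem_union _ (_) _ _ _).2
      (((@Finset.mem_union _ (_) _ _ _).1 hv).imp (hX.1 v) (hY.1 v))
  interClosed := by
    intro X hX Y hY Z hZ hXY
    refine conf_of_subset hX (@Finset.inter_subset_left _ (_) _ _) fun v hv => ?_
    exact (@Finset.mem_inter _ (_) _ _ _).2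
      (((@Finset.mem_inter _ (_) _ _ _).1 hv).imp (hX.1 v) (hY.1 v))

/-- The five shapes of configurations of a `graphCS`. -/
def shape (k : Fin 5) (v w : V) : Finset (V × Bool) :=
  match k with
  | 0 => ∅
  | 1 => {(v, false)}
  | 2 => {(v, false), (v, true)}
  | 3 => {(v, false), (w, false)}
  | 4 => {(v, false), (v, true), (w, false)}

theorem shape_mem_conf (k : Fin 5) {v w : V} (h : out v w) :
    shape k v w ∈ (graphCS out).Conf := by
  refine ⟨?_, v, w, h, ?_⟩
  · intro u
    fin_cases k <;> simp [shape]; tauto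
  · intro e
    fin_cases k <;> simp [shape] <;> tauto

theorem exists_shape (hout : ∀ v, ∃ w, out v w) {X : Finset (V × Bool)}
    (hX : X ∈ (graphCS out).Conf) : ∃ k v w, out v w ∧ X = shape k v w := by
  obtain ⟨hc, v, w, hvw, hX⟩ := hX
  obtain ⟨u, hwu⟩ := hout w
  have hv := hc v
  by_cases h1 : (v, false) ∈ X <;> by_cases h2 : (v, true) ∈ X <;>
    by_cases h3 : (w, false) ∈ X
  · refine ⟨4, v, w, hvw, ?_⟩
    ext e; have := hX e; simp [shape]; grind
  · refine ⟨2, v, w, hvw, ?_⟩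
    ext e; have := hX e; simp [shape]; grind
  · refine ⟨3, v, w, hvw, ?_⟩
    ext e; have := hX e; simp [shape]; grind
  · refine ⟨1, v, w, hvw, ?_⟩
    ext e; have := hX e; simp [shape]; grind
  · exact absurd (hv h2) h1
  · exact absurd (hv h2) h1
  · refine ⟨1, w, u, hwu, ?_⟩
    ext e; have := hX e; simp [shape]; grind
  · refine ⟨0, v, w, hvw, ?_⟩
    ext e; have := hX e; simp [shape]; grind

theorem card_shape (k : Fin 5) {v w : V} (h : v ≠ w) :
    (shape k v w).card = ![0, 1, 2, 2, 3] k := by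
  have h1 : (v, false) ≠ (w, false) := by simpa using h
  have h2 : (v, true) ≠ (w, false) := by simp
  have h3 : (v, false) ≠ (v, true) := by simp
  fin_cases k <;> simp [shape, Finset.card_insert_of_notMem, h]

theorem shape_iso (k : Fin 5) {v w : V} {v' w' : W} (h : out v w) (h' : out' v' w')
    (hne : v ≠ w) (hne' : v' ≠ w') :
    IsIso (graphCS out) (graphCS out') (shape k v w) (shape k v' w')
      (fun e => (if e.1 = v then v' else w', e.2)) := by
  rw [isIso_iff (shape_mem_conf k h) (shape_mem_conf k h')]
  have := hne.symm
  have := hne'.symm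
  fin_cases k <;> simp [shape, Prec, *]

theorem shape_tranA {k l : Fin 5} {v w : V} (h : out v w) (hne : v ≠ w)
    (hkl : (![0, 1, 2, 2, 3] : Fin 5 → ℕ) l = ![0, 1, 2, 2, 3] k + 1) (a : Unit) :
    (graphCS out).TranA (shape k v w) (shape l v w) a := by
  rw [tranA_iff]
  refine ⟨shape_mem_conf k h, shape_mem_conf l h, ?_⟩
  have := hne.symm
  fin_cases k <;> fin_cases l <;> simp at hkl
  · exact ⟨(v, false), by simp [shape]⟩
  · exact ⟨(v, true), by simp [shape], by simp [shape, or_comm]⟩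
  · exact ⟨(w, false), by simp [shape, *], by simp [shape]; tauto⟩
  · exact ⟨(w, false), by simp [shape, *], by simp [shape]; tauto⟩
  · exact ⟨(v, true), by simp [shape], by simp [shape, or_left_comm]⟩

theorem card_of_tranA {X X' : Finset (V × Bool)} {a : Unit} (h : (graphCS out).TranA X X' a) :
    X'.card = X.card + 1 := by
  obtain ⟨-, -, e, he, h⟩ := tranA_iff.1 h
  rw [← Finset.card_insert_of_notMem he]
  congr 1
  ext x
  rw [h, Finset.mem_insert]

theorem IsIso.card_eq {E₁ E₂ A : Type} {C : CS E₁ A} {D : CS E₂ A} {X : Finset E₁}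
    {Y : Finset E₂} {f : E₁ → E₂} (h : IsIso C D X Y f) : X.card = Y.card :=
  Finset.card_bij (fun e _ => f e) h.1 (fun d hd e he => h.2.1 d hd e he)
    (fun e' he' => by simpa using h.2.2.1 e' he')

theorem shape_eq_of_iso {k l : Fin 5} {v w : V} {v' w' : W} {f : V × Bool → W × Bool}
    (h : out v w) (h' : out' v' w') (hne : v ≠ w) (hne' : v' ≠ w')
    (hf : IsIso (graphCS out) (graphCS out') (shape k v w) (shape l v' w') f) : k = l := by
  have hc := hf.card_eq
  rw [card_shape k hne, card_shape l hne'] at hc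
  obtain ⟨h1, h2, h3, h4⟩ := (isIso_iff (shape_mem_conf k h) (shape_mem_conf l h')).1 hf
  fin_cases k <;> fin_cases l <;> simp at hc ⊢
  · have a := h1 (v, false) (by simp [shape])
    have b := h1 (v, true) (by simp [shape])
    have c := h2 (v, false) (by simp [shape]) (v, true) (by simp [shape])
    have d := (h4 (v, false) (by simp [shape]) (v, true) (by simp [shape])).1 ⟨rfl, by simp⟩
    rcases d.eq_or with d | ⟨u, -, d⟩
    · simp [d] at c
    · simp [d, shape] at b
  · obtain ⟨d, hd, hd'⟩ := h3 (v', false) (by simp [shape])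
    obtain ⟨e, he, he'⟩ := h3 (v', true) (by simp [shape])
    have hp := (h4 d hd e he).2 (by rw [hd', he']; exact ⟨rfl, by simp⟩)
    rcases hp.eq_or with rfl | ⟨u, -, rfl⟩
    · rw [hd'] at he'; simp at he'
    · simp [shape] at he

theorem shape_forth (hout : ∀ v, ∃ w, out v w) (hout' : ∀ v, ∃ w, out' v w)
    (hirr : ∀ v, ¬ out v v) (hirr' : ∀ v, ¬ out' v v)
    {X X' : Finset (V × Bool)} {Y : Finset (W × Bool)} {f : V × Bool → W × Bool} {a : Unit}
    (hY : Y ∈ (graphCS out').Conf) (hf : IsIso (graphCS out) (graphCS out') X Y f)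
    (hX : (graphCS out).TranA X X' a) :
    ∃ k v w v' w', out v w ∧ out' v' w' ∧ v ≠ w ∧ v' ≠ w' ∧ X' = shape k v w ∧
      (graphCS out').TranA Y (shape k v' w') a := by
  have hne : ∀ {v w}, out v w → v ≠ w := fun h e => hirr _ (e ▸ h)
  have hne' : ∀ {v w}, out' v w → v ≠ w := fun h e => hirr' _ (e ▸ h)
  have hX2 := tranA_iff.1 hX
  obtain ⟨k, v, w, hvw, rfl⟩ := exists_shape hout hX2.1
  obtain ⟨l, p, q, hpq, rfl⟩ := exists_shape hout hX2.2.1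
  obtain ⟨m, v', w', hvw', rfl⟩ := exists_shape hout' hY
  obtain rfl := shape_eq_of_iso hvw hvw' (hne hvw) (hne' hvw') hf
  have hc := card_of_tranA hX
  rw [card_shape _ (hne hvw), card_shape _ (hne hpq)] at hc
  exact ⟨l, p, q, v', w', hpq, hvw', hne hpq, hne' hvw', rfl,
    shape_tranA hvw' (hne' hvw') hc a⟩

theorem IsIso.exists_symm {X : Finset (V × Bool)} {Y : Finset (W × Bool)}
    {f : V × Bool → W × Bool} [Nonempty V] (hX : X ∈ (graphCS out).Conf)
    (hY : Y ∈ (graphCS out').Conf) (hf : IsIso (graphCS out) (graphCS out') X Y f) :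
    ∃ g, IsIso (graphCS out') (graphCS out) Y X g := by
  obtain ⟨h1, h2, h3, h4⟩ := (isIso_iff hX hY).1 hf
  choose! g hg hfg using h3
  refine ⟨g, (isIso_iff hY hX).2 ⟨hg, ?_, ?_, ?_⟩⟩
  · intro d hd e he h
    rw [← hfg d hd, ← hfg e he, h]
  · exact fun e he => ⟨f e, h1 e he, h2 _ (hg _ (h1 e he)) _ he (hfg _ (h1 e he))⟩
  · intro d hd e he
    rw [h4 _ (hg d hd) _ (hg e he), hfg d hd, hfg e he]

theorem IsIso.erase {X : Finset (V × Bool)} {Y : Finset (W × Bool)} {f : V × Bool → W × Bool}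
    {e : V × Bool} (hX : X ∈ (graphCS out).Conf) (hY : Y ∈ (graphCS out').Conf)
    (hX' : X.erase e ∈ (graphCS out).Conf) (hY' : Y.erase (f e) ∈ (graphCS out').Conf)
    (he : e ∈ X) (hf : IsIso (graphCS out) (graphCS out') X Y f) :
    IsIso (graphCS out) (graphCS out') (X.erase e) (Y.erase (f e)) f := by
  obtain ⟨h1, h2, h3, h4⟩ := (isIso_iff hX hY).1 hf
  refine (isIso_iff hX' hY').2 ⟨?_, ?_, ?_, ?_⟩
  · intro d hd
    rw [Finset.mem_erase] at hd ⊢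
    exact ⟨fun h => hd.1 (h2 d hd.2 e he h), h1 d hd.2⟩
  · exact fun d hd c hc => h2 d (Finset.mem_of_mem_erase hd) c (Finset.mem_of_mem_erase hc)
  · intro d hd
    rw [Finset.mem_erase] at hd
    obtain ⟨c, hc, rfl⟩ := h3 d hd.2
    exact ⟨c, Finset.mem_erase.2 ⟨fun h => hd.1 (h ▸ rfl), hc⟩, rfl⟩
  · exact fun d hd c hc => h4 d (Finset.mem_of_mem_erase hd) c (Finset.mem_of_mem_erase hc)

theorem rtranA_iff {X X' : Finset (V × Bool)} {a : Unit} :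
    (graphCS out).RTranA X X' a ↔ X ∈ (graphCS out).Conf ∧ X' ∈ (graphCS out).Conf ∧
      ∃ e ∈ X, X' = X.erase e := by
  rw [CS.RTranA, tranA_iff]
  constructor
  · rintro ⟨h1, h2, e, he, h⟩
    refine ⟨h2, h1, e, (h e).2 (Or.inl rfl), ?_⟩
    ext x
    rw [Finset.mem_erase, h]
    constructor
    · exact fun hx => ⟨fun h => he (h ▸ hx), Or.inr hx⟩
    · tauto
  · rintro ⟨h1, h2, e, he, rfl⟩
    refine ⟨h2, h1, e, by simp, fun x => ?_⟩
    rw [Finset.mem_erase]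
    by_cases hx : x = e
    · simp [hx, he]
    · simp [hx]

theorem eq_of_prec_of_erase_mem_conf {X : Finset (V × Bool)} {e d : V × Bool}
    (hX : X.erase e ∈ (graphCS out).Conf) (hd : d ∈ X) (h : Prec e d) : d = e := by
  by_contra hne
  simpa using mem_of_prec hX (Finset.mem_erase.2 ⟨hne, hd⟩) h

theorem hwhEquiv_graphCS [Nonempty V] [Nonempty W] (hout : ∀ v, ∃ w, out v w)
    (hout' : ∀ v, ∃ w, out' v w) (hirr : ∀ v, ¬ out v v) (hirr' : ∀ v, ¬ out' v v) :
    HWHEquiv (graphCS out) (graphCS out') := by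
  obtain ⟨v₀⟩ := ‹Nonempty V›
  obtain ⟨w₀⟩ := ‹Nonempty W›
  have hC : ∅ ∈ (graphCS out).Conf := empty_mem_conf ⟨v₀, hout v₀⟩
  have hD : ∅ ∈ (graphCS out').Conf := empty_mem_conf ⟨w₀, hout' w₀⟩
  refine ⟨fun X Y f => X ∈ (graphCS out).Conf ∧ Y ∈ (graphCS out').Conf ∧
    IsIso (graphCS out) (graphCS out') X Y f, ?_, ?_, ?_, ?_, ?_, ?_⟩
  · exact ⟨fun _ => (w₀, false), hC, hD, (isIso_iff hC hD).2 (by simp)⟩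
  · exact fun _ _ _ h => h.2.2
  · rintro X Y f a X' ⟨hX, hY, hf⟩ hX'
    obtain ⟨k, v, w, v', w', h, h', hne, hne', rfl, hY'⟩ :=
      shape_forth hout hout' hirr hirr' hY hf hX'
    exact ⟨_, _, hY', shape_mem_conf k h, shape_mem_conf k h', shape_iso k h h' hne hne'⟩
  · rintro X Y f a Y' ⟨hX, hY, hf⟩ hY'
    obtain ⟨g, hg⟩ := hf.exists_symm hX hY
    obtain ⟨k, v, w, v', w', h, h', hne, hne', rfl, hX'⟩ :=
      shape_forth hout' hout hirr' hirr hX hg hY'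
    exact ⟨_, _, hX', shape_mem_conf k h', shape_mem_conf k h, shape_iso k h' h hne' hne⟩
  · rintro X Y f a X' ⟨hX, hY, hf⟩ hX'
    obtain ⟨-, hXe, e, he, rfl⟩ := rtranA_iff.1 hX'
    obtain ⟨h1, h2, h3, h4⟩ := (isIso_iff hX hY).1 hf
    have hYe : Y.erase (f e) ∈ (graphCS out').Conf := by
      refine erase_mem_conf hY fun d' hd' hp => ?_
      obtain ⟨d, hd, rfl⟩ := h3 d' hd'
      rw [eq_of_prec_of_erase_mem_conf hXe hd ((h4 e he d hd).2 hp)]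
    exact ⟨_, f, rtranA_iff.2 ⟨hY, hYe, _, h1 e he, rfl⟩,
      ⟨hXe, hYe, hf.erase hX hY hXe hYe he⟩, fun _ _ => rfl⟩
  · rintro X Y f a Y' ⟨hX, hY, hf⟩ hY'
    obtain ⟨-, hYe, e', he', rfl⟩ := rtranA_iff.1 hY'
    obtain ⟨h1, h2, h3, h4⟩ := (isIso_iff hX hY).1 hf
    obtain ⟨e, he, rfl⟩ := h3 e' he'
    have hXe : X.erase e ∈ (graphCS out).Conf := by
      refine erase_mem_conf hX fun d hd hp => h2 d hd e he ?_
      exact eq_of_prec_of_erase_mem_conf hYe (h1 d hd) ((h4 e he d hd).1 hp)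
    exact ⟨_, f, rtranA_iff.2 ⟨hX, hXe, _, he, rfl⟩,
      ⟨hXe, hYe, hf.erase hX hY hXe hYe he⟩, fun _ _ => rfl⟩

theorem image_mem_conf {c : V} {g : V → W}
    (hg : ∀ v w, out v w → c = v ∨ c = w → out' (g v) (g w)) {X : Finset (V × Bool)}
    (hX : X ∈ (graphCS out).Conf) (hc : (c, false) ∈ X) :
    X.image (Prod.map g id) ∈ (graphCS out').Conf := by
  obtain ⟨h1, v, w, hvw, h2⟩ := hX
  constructor
  · intro u hu
    rw [Finset.mem_image] at hu ⊢
    obtain ⟨⟨p, b⟩, hp, he⟩ := hu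
    obtain ⟨rfl, rfl⟩ : g p = u ∧ b = true := by simpa using he
    exact ⟨(p, false), h1 p hp, rfl⟩
  · refine ⟨g v, g w, hg v w hvw (by simpa using h2 _ hc), fun e he => ?_⟩
    obtain ⟨d, hd, rfl⟩ := Finset.mem_image.1 he
    rcases h2 d hd with rfl | rfl | rfl <;> simp

theorem isIso_image {c : V} {g : V → W} {s : W → V}
    (hg : ∀ v w, out v w → c = v ∨ c = w → out' (g v) (g w))
    (hsg : ∀ v w, out v w → c = v ∨ c = w → s (g v) = v ∧ s (g w) = w)
    {X : Finset (V × Bool)} (hX : X ∈ (graphCS out).Conf) (hc : (c, false) ∈ X) :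
    (∀ e ∈ X, Prod.map s id (Prod.map g id e) = e) ∧
      IsIso (graphCS out) (graphCS out') X (X.image (Prod.map g id)) (Prod.map g id) := by
  have hinv : ∀ e ∈ X, s (g e.1) = e.1 := by
    obtain ⟨-, v, w, hvw, h2⟩ := id hX
    obtain ⟨hv, hw⟩ := hsg v w hvw (by simpa using h2 _ hc)
    intro e he
    rcases h2 e he with rfl | rfl | rfl <;> assumption
  refine ⟨fun e he => Prod.ext (hinv e he) rfl, (isIso_iff hX (image_mem_conf hg hX hc)).2
    ⟨fun e he => Finset.mem_image_of_mem _ he, ?_, fun e he => by simpa using he, ?_⟩⟩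
  · intro d hd e he h
    rw [Prod.ext_iff] at h
    exact Prod.ext (by rw [← hinv d hd, ← hinv e he]; exact congrArg s h.1) h.2
  · intro d hd e he
    refine and_congr_left' ⟨congrArg g, fun h => ?_⟩
    rw [← hinv d hd, ← hinv e he]
    exact congrArg s h

theorem eq_singleton_of_tranA_empty {X : Finset (V × Bool)} {a : Unit}
    (h : (graphCS out).TranA ∅ X a) : ∃ v, X = {(v, false)} := by
  obtain ⟨-, hX, e, -, h⟩ := tranA_iff.1 h
  obtain ⟨v, b⟩ := e
  have he : (v, b) ∈ X := (h _).2 (Or.inl rfl)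
  cases b
  · refine ⟨v, ?_⟩
    ext x
    simp [h]
  · have := (h _).1 (hX.1 v he)
    simp at this

theorem tranA_empty {v w : V} (h : out v w ∨ out w v) (a : Unit) :
    (graphCS out).TranA ∅ {(v, false)} a := by
  have hv : {(v, false)} ∈ (graphCS out).Conf := by
    refine ⟨by simp, ?_⟩
    rcases h with h | h
    · exact ⟨v, w, h, by simp⟩
    · exact ⟨w, v, h, by simp⟩
  refine tranA_iff.2 ⟨conf_of_subset hv (by simp) (by simp), hv, (v, false), by simp, by simp⟩

/-- If the star of every vertex is mapped isomorphically to a star, with every star reached, then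
the associated structures are history-preserving equivalent. -/
theorem hEquiv_graphCS {g : V → V → W} {s : V → W → V} {i : W → V}
    (hout' : ∀ v, ∃ w, out' v w) (hout : ∀ v, ∃ w, out v w)
    (hV : ∃ v w, out v w) (hi : ∀ w, g (i w) (i w) = w)
    (hg : ∀ c v w, out v w → c = v ∨ c = w → out' (g c v) (g c w))
    (hs : ∀ c v w, out' v w → g c c = v ∨ g c c = w → out (s c v) (s c w))
    (hsg : ∀ c v w, out v w → c = v ∨ c = w → s c (g c v) = v ∧ s c (g c w) = w)
    (hgs : ∀ c w, g c (s c w) = w) :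
    HEquiv (graphCS out) (graphCS out') := by
  obtain ⟨v₀, w₀, h₀⟩ := hV
  have hC : ∅ ∈ (graphCS out).Conf := empty_mem_conf ⟨v₀, w₀, h₀⟩
  have hD : ∅ ∈ (graphCS out').Conf := empty_mem_conf ⟨_, _, hg v₀ v₀ w₀ h₀ (Or.inl rfl)⟩
  refine ⟨fun X Y f => (X = ∅ ∧ Y = ∅) ∨ ∃ c, (c, false) ∈ X ∧ X ∈ (graphCS out).Conf ∧
    Y = X.image (Prod.map (g c) id) ∧ f = Prod.map (g c) id, ?_, ?_, ?_, ?_⟩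
  · exact ⟨Prod.map (g v₀) id, Or.inl ⟨rfl, rfl⟩⟩
  · rintro X Y f (⟨rfl, rfl⟩ | ⟨c, hc, hX, rfl, rfl⟩)
    · exact (isIso_iff hC hD).2 (by simp)
    · exact (isIso_image (hg c) (hsg c) hX hc).2
  · rintro X Y f a X' (⟨rfl, rfl⟩ | ⟨c, hc, hX, rfl, rfl⟩) hX'
    · obtain ⟨v, rfl⟩ := eq_singleton_of_tranA_empty hX'
      obtain ⟨w, hw⟩ := hout' (g v v)
      exact ⟨{(g v v, false)}, Prod.map (g v) id, tranA_empty (Or.inl hw) a,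
        Or.inr ⟨v, by simp, (tranA_iff.1 hX').2.1, by simp, rfl⟩, by simp⟩
    · obtain ⟨-, hX', e, he, h⟩ := tranA_iff.1 hX'
      have hc' : (c, false) ∈ X' := (h _).2 (Or.inr hc)
      refine ⟨_, _, tranA_iff.2 ⟨image_mem_conf (hg c) hX hc, image_mem_conf (hg c) hX' hc',
        Prod.map (g c) id e, ?_, ?_⟩, Or.inr ⟨c, hc', hX', rfl, rfl⟩, fun _ _ => rfl⟩
      · rw [Finset.mem_image]
        rintro ⟨d, hd, hde⟩
        have hinv := (isIso_image (hg c) (hsg c) hX' hc').1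
        have := hinv d ((h _).2 (Or.inr hd))
        rw [hde, hinv e ((h _).2 (Or.inl rfl))] at this
        exact he (this ▸ hd)
      · intro x
        simp only [Finset.mem_image, h, or_and_right, exists_or, exists_eq_left, eq_comm (a := x)]
  · rintro X Y f a Y' (⟨rfl, rfl⟩ | ⟨c, hc, hX, rfl, rfl⟩) hY'
    · obtain ⟨w, rfl⟩ := eq_singleton_of_tranA_empty hY'
      obtain ⟨u, hu⟩ := hout (i w)
      have hv := tranA_empty (Or.inl hu) a
      exact ⟨{(i w, false)}, Prod.map (g (i w)) id, hv,
        Or.inr ⟨i w, by simp, (tranA_iff.1 hv).2.1, by simp [hi], rfl⟩, by simp⟩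
    · obtain ⟨-, hY', e, he, h⟩ := tranA_iff.1 hY'
      have hc' : (g c c, false) ∈ Y' :=
        (h _).2 (Or.inr (Finset.mem_image.2 ⟨_, hc, rfl⟩))
      have hinv := (isIso_image (hg c) (hsg c) hX hc).1
      have hinv' : ∀ y : W × Bool, Prod.map (g c) id (Prod.map (s c) id y) = y :=
        fun y => Prod.ext (hgs c y.1) rfl
      have hX' := image_mem_conf (hs c) hY' hc'
      have hmem : ∀ x, x ∈ Y'.image (Prod.map (s c) id) ↔
          x = Prod.map (s c) id e ∨ x ∈ X := by
        intro x
        rw [Finset.mem_image]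
        constructor
        · rintro ⟨y, hy, rfl⟩
          rcases (h y).1 hy with rfl | hy
          · exact Or.inl rfl
          · obtain ⟨x, hx, rfl⟩ := Finset.mem_image.1 hy
            exact Or.inr ((hinv x hx).symm ▸ hx)
        · rintro (rfl | hx)
          · exact ⟨e, (h _).2 (Or.inl rfl), rfl⟩
          · exact ⟨_, (h _).2 (Or.inr (Finset.mem_image_of_mem _ hx)), hinv x hx⟩
      refine ⟨_, _, tranA_iff.2 ⟨hX, hX', Prod.map (s c) id e, ?_, hmem⟩,
        Or.inr ⟨c, (hmem _).2 (Or.inr hc), hX', ?_, rfl⟩, fun _ _ => rfl⟩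
      · exact fun hx => he (Finset.mem_image.2 ⟨_, hx, hinv' e⟩)
      · ext y
        simp [Finset.mem_image, -Prod.exists, hinv']

theorem IsHBisim.out_of_pair {R} (hR : IsHBisim (graphCS out) (graphCS out') R)
    (hirr : ∀ v, ¬ out v v) {v w : V} (h : out v w) {X : Finset (V × Bool)}
    {Y : Finset (W × Bool)} {f : V × Bool → W × Bool} (hRf : R X Y f)
    (hX : ∀ x, x ∈ X ↔ x = (v, false) ∨ x = (w, false)) :
    ∃ v' w', out' v' w' ∧ f (v, false) = (v', false) ∧ f (w, false) = (w', false) := by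
  have hne : v ≠ w := fun e => hirr _ (e ▸ h)
  have hXc : X ∈ (graphCS out).Conf := by
    refine ⟨fun u hu => by simp [hX] at hu, v, w, h, fun e he => ?_⟩
    have := (hX e).1 he
    tauto
  have hXc' : shape 4 v w ∈ (graphCS out).Conf := shape_mem_conf 4 h
  obtain ⟨Y', f', hY', hR', hff⟩ := hR.forth _ _ _ () (shape 4 v w) hRf
    (tranA_iff.2 ⟨hXc, hXc', (v, true), by simp [hX], fun x => by simp [hX, shape]; tauto⟩)
  rw [← hff (v, false) ((hX _).2 (Or.inl rfl)), ← hff (w, false) ((hX _).2 (Or.inr rfl))]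
  have hYc := (tranA_iff.1 hY').2.1
  obtain ⟨h1, h2, -, h4⟩ := (isIso_iff hXc' hYc).1 (hR.iso _ _ _ hR')
  have m1 : (v, false) ∈ shape 4 v w := by simp [shape]
  have m2 : (v, true) ∈ shape 4 v w := by simp [shape]
  have m3 : (w, false) ∈ shape 4 v w := by simp [shape]
  rcases ((h4 _ m1 _ m2).1 ⟨rfl, by simp⟩).eq_or with he | ⟨v', hv1, hv2⟩
  · simpa using h2 _ m1 _ m2 he
  · obtain ⟨-, p, q, hpq, hY⟩ := hYc
    have hp : v' = p := by simpa [hv2] using hY _ (h1 _ m2)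
    subst hp
    have hw := hY _ (h1 _ m3)
    rw [← hv1, ← hv2] at hw
    rcases hw with hw | hw | hw
    · exact absurd (h2 _ m3 _ m1 hw) (by simpa using hne.symm)
    · simpa using h2 _ m3 _ m2 hw
    · exact ⟨v', q, hpq, hv1, hw⟩

end GraphStructures

/-- The path `0 → 1 ⇄ 2`. -/
def pathEdge (v w : Fin 3) : Prop :=
  (v, w) = (0, 1) ∨ (v, w) = (1, 2) ∨ (v, w) = (2, 1)

/-- The path `0 → 1 ⇄ 2` together with a disjoint component `3 ⇄ 4`. -/
def pathPairEdge (v w : Fin 5) : Prop :=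
  (v, w) = (0, 1) ∨ (v, w) = (1, 2) ∨ (v, w) = (2, 1) ∨ (v, w) = (3, 4) ∨ (v, w) = (4, 3)

instance : DecidableRel pathEdge := fun _ _ => by unfold pathEdge; infer_instance

instance : DecidableRel pathPairEdge := fun _ _ => by unfold pathPairEdge; infer_instance

theorem hEquiv_path : HEquiv (graphCS pathPairEdge) (graphCS pathEdge) :=
  hEquiv_graphCS (g := fun c => if c = 4 then ![0, 1, 2, 1, 2] else ![0, 1, 2, 2, 1])
    (s := fun c => if c = 4 then ![0, 3, 4] else if c = 3 then ![0, 4, 3] else ![0, 1, 2])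
    (i := ![0, 1, 2]) (by decide) (by decide) (by decide) (by decide) (by decide) (by decide)
    (by decide) (by decide)

theorem IsHBisim.ne_one_of_isolated_edge {R}
    (hR : IsHBisim (graphCS pathPairEdge) (graphCS pathEdge) R) {v w : Fin 5}
    (hvw : ∀ u, pathPairEdge v u ∨ pathPairEdge u v → u = w) (hw : pathPairEdge v w)
    {Y : Finset (Fin 3 × Bool)} {f : Fin 5 × Bool → Fin 3 × Bool}
    (hRf : R {(v, false)} Y f) : f (v, false) ≠ (1, false) := by
  intro hf
  have hX : {(v, false)} ∈ (graphCS pathPairEdge).Conf := ⟨by simp, v, w, hw, by simp⟩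
  obtain ⟨h1, -, h3, -⟩ := hR.iso _ _ _ hRf
  have hY : ∀ y, y ∈ Y ↔ y = (1, false) := by
    intro y
    constructor
    · intro hy
      obtain ⟨e, he, rfl⟩ := h3 y hy
      rw [Finset.mem_singleton.1 he, hf]
    · rintro rfl
      exact hf ▸ h1 (v, false) (by simp)
  have hYc : Y ∈ (graphCS pathEdge).Conf :=
    ⟨fun u hu => by simp [hY] at hu, 1, 2, by decide, fun e he => Or.inl ((hY e).1 he)⟩
  have hYc' := shape_mem_conf (out := pathEdge) 3 (v := 0) (w := 1) (by decide)
  obtain ⟨X', f', hX', hR', hff⟩ := hR.back _ _ _ () _ hRf (tranA_iff.2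
    ⟨hYc, hYc', (0, false), by simp [hY], fun y => by simp [hY, shape]⟩)
  obtain ⟨-, hXc', e, he, hXe⟩ := tranA_iff.1 hX'
  obtain ⟨h1, h2, h3, h4⟩ := (isIso_iff hXc' hYc').1 (hR.iso _ _ _ hR')
  have hv : (v, false) ∈ X' := (hXe _).2 (Or.inr (by simp))
  have hfv : f' (v, false) = (1, false) := by rw [hff _ (by simp), hf]
  have hfe : f' e = (0, false) := by
    obtain ⟨d, hd, hd'⟩ := h3 (0, false) (by simp [shape])
    rcases (hXe d).1 hd with rfl | h
    · exact hd'
    · rw [Finset.mem_singleton.1 h, hfv] at hd'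
      simp at hd'
  have he' : e ∈ X' := (hXe _).2 (Or.inl rfl)
  have hve : e ≠ (v, true) := by
    rintro rfl
    have := (h4 _ hv _ he').1 ⟨rfl, by simp⟩
    rw [hfv, hfe] at this
    exact absurd this.1 (by decide)
  have hew : e = (w, false) := by
    have hev : e ≠ (v, false) := fun h => he (by simp [h])
    have het : ∀ u, e ≠ (u, true) := by
      rintro u rfl
      rcases (hXe _).1 (hXc'.1 u he') with h | h
      · simp at h
      · exact hve (by simpa using h)
    obtain ⟨-, p, q, hpq, hX'⟩ := hXc'
    have a := hX' _ hv
    have b := hX' _ he'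
    simp only [Prod.mk.injEq, and_true, Bool.false_eq_true, and_false, false_or] at a
    rcases a with rfl | rfl
    · rcases b with b | b | b
      · exact absurd b hev
      · exact absurd b (het _)
      · rw [b, hvw q (Or.inl hpq)]
    · rcases b with b | b | b
      · rw [b, hvw p (Or.inr hpq)]
      · exact absurd b (het _)
      · exact absurd b hev
  subst hew
  obtain ⟨v', w', ho, hv', hw'⟩ := hR.out_of_pair (by decide) hw hR'
    (fun x => by rw [hXe]; simp [or_comm])
  rw [hfv] at hv'
  rw [hfe] at hw'
  simp only [Prod.mk.injEq, and_true] at hv' hw'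
  subst hv' hw'
  exact absurd ho (by decide)

theorem not_hhEquiv_path : ¬ HHEquiv (graphCS pathPairEdge) (graphCS pathEdge) := by
  rintro ⟨R, hR⟩
  obtain ⟨f₀, h₀⟩ := hR.root
  have e34 : pathPairEdge 3 4 := by decide
  have e43 : pathPairEdge 4 3 := by decide
  obtain ⟨Y₁, f₁, -, h₁, -⟩ := hR.forth _ _ _ () _ h₀ (tranA_empty (Or.inl e34) ())
  have c3 : {(3, false)} ∈ (graphCS pathPairEdge).Conf := ⟨by simp, 3, 4, e34, by simp⟩
  have c4 : {(4, false)} ∈ (graphCS pathPairEdge).Conf := ⟨by simp, 4, 3, e43, by simp⟩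
  have c34 := shape_mem_conf (out := pathPairEdge) 3 e34
  have t3 : (graphCS pathPairEdge).TranA {(3, false)} (shape 3 3 4) () :=
    tranA_iff.2 ⟨c3, c34, (4, false), by simp, fun x => by simp [shape, or_comm]⟩
  have t4 : (graphCS pathPairEdge).TranA {(4, false)} (shape 3 3 4) () :=
    tranA_iff.2 ⟨c4, c34, (3, false), by simp, fun x => by simp [shape]⟩
  obtain ⟨Y₂, f₂, -, h₂, -⟩ := hR.forth _ _ _ () _ h₁ t3
  obtain ⟨v, w, hvw, hv, hw⟩ := hR.toIsHBisim.out_of_pair (by decide) e34 h₂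
    (fun x => by simp [shape])
  obtain ⟨w', v', hwv, hw', hv'⟩ := hR.toIsHBisim.out_of_pair (by decide) e43 h₂
    (fun x => by simp [shape, or_comm])
  obtain rfl : v = v' := by simpa [hv] using hv'
  obtain rfl : w = w' := by simpa [hw] using hw'
  have hone : v = 1 ∨ w = 1 := by
    clear hv hw hv' hw'
    revert v w
    decide
  rcases hone with rfl | rfl
  · obtain ⟨Y₃, f₃, -, h₃, hf⟩ := hR.rforth _ _ _ () _ h₂ t3
    exact hR.toIsHBisim.ne_one_of_isolated_edge (w := 4) (by decide) (by decide) h₃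
      (by rw [← hf _ (by simp), hv])
  · obtain ⟨Y₃, f₃, -, h₃, hf⟩ := hR.rforth _ _ _ () _ h₂ t4
    exact hR.toIsHBisim.ne_one_of_isolated_edge (w := 3) (by decide) (by decide) h₃
      (by rw [← hf _ (by simp), hw])


/-- there exist finite stable configuration structures over a
one-letter alphabet (all events labelled `a`) that are H equivalent and HWH
equivalent, but not HH equivalent. -/
theorem stmt13 :
    ∃ (E1 E2 : Type) (C : CS E1 Unit) (D : CS E2 Unit),
      C.Stable ∧ C.Finite ∧ D.Stable ∧ D.Finite ∧
      HEquiv C D ∧ HWHEquiv C D ∧ ¬ HHEquiv C D := by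
  exact ⟨_, _, graphCS pathPairEdge, graphCS pathEdge, graphCS_stable (by decide),
    Set.toFinite _, graphCS_stable (by decide), Set.toFinite _, hEquiv_path,
    hwhEquiv_graphCS (by decide) (by decide) (by decide) (by decide), not_hhEquiv_path⟩

end EILPaper
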